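/- For every invertible 16×16 matrix G over GF(2) with partial distances D_1,…,D_16, one has ∏_{i=1}^{16} D_i ≤ 2³⁰ · 3²; consequently E_16 = (30 + 2·log₂3)/64, i.e., the exponent 0.51828… is the best possible among all 16×16 matrices. -/

import Mathlib

/-- The partial distance `D_i` of the `i`-th row of `G` (0-indexed): the Hamming
distance from row `i` to the GF(2)-linear span of the rows below it. For the last
row the span is `{0}`, so `D_ℓ` is the Hamming weight of the last row. -/
noncomputable def partialDist {ℓ : ℕ} (G : Matrix (Fin ℓ) (Fin ℓ) (ZMod 2)) (i : Fin ℓ) : ℕ :=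
  sInf {d : ℕ | ∃ c ∈ Submodule.span (ZMod 2) {v : Fin ℓ → ZMod 2 | ∃ j, i < j ∧ v = G j},
    d = hammingDist (G i) c}

/-- The exponent `E(G) = (1/ℓ) ∑_i log_ℓ D_i`. -/
noncomputable def expE {ℓ : ℕ} (G : Matrix (Fin ℓ) (Fin ℓ) (ZMod 2)) : ℝ :=
  (1 / ℓ : ℝ) * ∑ i, Real.logb ℓ (partialDist G i)

/-- `E_ℓ`: the maximum of `E(G)` over invertible `ℓ×ℓ` matrices over GF(2). -/
noncomputable def Emax (ℓ : ℕ) : ℝ :=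
  sSup {x : ℝ | ∃ G : Matrix (Fin ℓ) (Fin ℓ) (ZMod 2), IsUnit G ∧ x = expE G}

/-- The sign character `ZMod 2 → {±1}`. -/
def sgn (a : ZMod 2) : ℤ := if a = 0 then 1 else -1

lemma sgn_add (a b : ZMod 2) : sgn (a + b) = sgn a * sgn b := by
  revert a b; decide

@[simp] lemma sgn_zero : sgn 0 = 1 := rfl

@[simp] lemma sgn_one : sgn 1 = -1 := rfl

lemma sgn_mul_self (a : ZMod 2) : sgn a * sgn a = 1 := by
  revert a; decide

lemma ZMod.two_eq_zero_or_one (a : ZMod 2) : a = 0 ∨ a = 1 := by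
  revert a; decide

lemma sgn_sum {ι : Type*} (s : Finset ι) (f : ι → ZMod 2) :
    sgn (∑ i ∈ s, f i) = ∏ i ∈ s, sgn (f i) := by
  classical
  induction s using Finset.induction_on with
  | empty => simp
  | insert a s ha ih => rw [Finset.sum_insert ha, Finset.prod_insert ha, sgn_add, ih]

section Words

variable {n : ℕ}

lemma add_self_word (v : Fin n → ZMod 2) : v + v = 0 := by
  funext i
  exact CharTwo.add_self_eq_zero (v i)

lemma hammingNorm_eq_card (v : Fin n → ZMod 2) :
    hammingNorm v = (Finset.univ.filter fun i => v i = 1).card := by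
  unfold hammingNorm
  congr 1
  ext i
  rcases ZMod.two_eq_zero_or_one (v i) with h | h <;> simp [h]

lemma hammingNorm_le (v : Fin n → ZMod 2) : hammingNorm v ≤ n := by
  simpa using hammingNorm_le_card_fintype (x := v)

lemma sum_sgn (v : Fin n → ZMod 2) : ∑ i, sgn (v i) = n - 2 * hammingNorm v := by
  have h : ∀ i, sgn (v i) = 1 - 2 * (if v i = 1 then 1 else 0) := by
    intro i
    rcases ZMod.two_eq_zero_or_one (v i) with h | h <;> simp [h]
  simp only [h, Finset.sum_sub_distrib, ← Finset.mul_sum, Finset.sum_boole, hammingNorm_eq_card]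
  simp

lemma sum_apply_eq_hammingNorm (v : Fin n → ZMod 2) : ∑ i, v i = (hammingNorm v : ZMod 2) := by
  rw [hammingNorm_eq_card, ← Finset.sum_boole]
  refine Finset.sum_congr rfl fun i _ => ?_
  rcases ZMod.two_eq_zero_or_one (v i) with h | h <;> simp [h]

lemma dotProduct_eq_hammingNorm_mul (u v : Fin n → ZMod 2) :
    u ⬝ᵥ v = (hammingNorm (u * v) : ZMod 2) :=
  sum_apply_eq_hammingNorm (u * v)

lemma hammingNorm_add_add (u v : Fin n → ZMod 2) :
    hammingNorm (u + v) + 2 * hammingNorm (u * v) = hammingNorm u + hammingNorm v := by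
  have h : ∀ i, sgn ((u + v) i) + 2 * sgn ((u * v) i) = sgn (u i) + sgn (v i) + 1 := by
    intro i
    simp only [Pi.add_apply, Pi.mul_apply]
    generalize u i = a
    generalize v i = b
    revert a b; decide
  have h' := Finset.sum_congr (rfl : (Finset.univ : Finset (Fin n)) = _) fun i _ => h i
  simp only [Finset.sum_add_distrib, ← Finset.mul_sum, sum_sgn] at h'
  simp at h'
  omega

lemma hammingNorm_add_single (v : Fin n → ZMod 2) (p : Fin n) :
    (hammingNorm (v + Pi.single p 1) : ℤ) = hammingNorm v + sgn (v p) := by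
  have h := hammingNorm_add_add v (Pi.single p 1)
  have h1 : hammingNorm (Pi.single p 1 : Fin n → ZMod 2) = 1 := by
    rw [hammingNorm_eq_card, Finset.card_eq_one]
    refine ⟨p, ?_⟩
    ext i
    by_cases hi : i = p <;> simp [hi, Pi.single_apply]
  have h2 : v * Pi.single p 1 = Pi.single p (v p) := by
    funext i
    by_cases hi : i = p
    · subst hi; simp
    · simp [hi]
  rw [h1, h2] at h
  rcases ZMod.two_eq_zero_or_one (v p) with hp | hp
  · rw [hp, Pi.single_zero, hammingNorm_zero] at h
    rw [hp, sgn_zero]; omega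
  · rw [hp, h1] at h
    rw [hp, sgn_one]; omega

lemma hammingNorm_add_one (v : Fin n → ZMod 2) : hammingNorm (v + 1) + hammingNorm v = n := by
  have h : ∑ i, sgn ((v + 1) i) = ∑ i, -sgn (v i) := by
    refine Finset.sum_congr rfl fun i _ => ?_
    simp [sgn_add]
  rw [Finset.sum_neg_distrib, sum_sgn, sum_sgn] at h
  omega

lemma eq_one_of_hammingNorm_eq {v : Fin n → ZMod 2} (h : hammingNorm v = n) : v = 1 := by
  have h1 := hammingNorm_add_one v
  have h2 : v + 1 = 0 := hammingNorm_eq_zero.1 (by omega)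
  have h3 : v + (1 + 1) = 1 := by rw [← add_assoc, h2, zero_add]
  rwa [add_self_word, add_zero] at h3

end Words

section Codes

variable {n : ℕ}

open Classical in
/-- The codewords of a binary linear code, as a finset. -/
noncomputable def codewords (C : Submodule (ZMod 2) (Fin n → ZMod 2)) : Finset (Fin n → ZMod 2) :=
  Finset.univ.filter (· ∈ C)

/-- The number of codewords of weight `w`. -/
noncomputable def wtCount (C : Submodule (ZMod 2) (Fin n → ZMod 2)) (w : ℕ) : ℕ :=
  ((codewords C).filter fun c => hammingNorm c = w).card

/-- The dual code. -/
def dualCode (C : Submodule (ZMod 2) (Fin n → ZMod 2)) : Submodule (ZMod 2) (Fin n → ZMod 2) where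
  carrier := {u | ∀ c ∈ C, u ⬝ᵥ c = 0}
  add_mem' hu hv c hc := by rw [add_dotProduct, hu c hc, hv c hc, add_zero]
  zero_mem' c _ := zero_dotProduct c
  smul_mem' a u hu c hc := by rw [smul_dotProduct, hu c hc, smul_zero]

variable {C : Submodule (ZMod 2) (Fin n → ZMod 2)}

@[simp] lemma mem_codewords {v : Fin n → ZMod 2} : v ∈ codewords C ↔ v ∈ C := by
  simp [codewords]

lemma mem_dualCode {u : Fin n → ZMod 2} : u ∈ dualCode C ↔ ∀ c ∈ C, u ⬝ᵥ c = 0 := Iff.rfl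

lemma card_codewords (C : Submodule (ZMod 2) (Fin n → ZMod 2)) :
    (codewords C).card = 2 ^ Module.finrank (ZMod 2) C := by
  classical
  have h := Module.card_eq_pow_finrank (K := ZMod 2) (V := C)
  rw [ZMod.card] at h
  rw [← h, codewords, Fintype.card_subtype]

lemma wtCount_mono {C D : Submodule (ZMod 2) (Fin n → ZMod 2)} (h : C ≤ D) (w : ℕ) :
    wtCount C w ≤ wtCount D w := by
  refine Finset.card_le_card (Finset.filter_subset_filter _ fun v hv => ?_)
  rw [mem_codewords] at hv ⊢
  exact h hv

lemma dualCode_anti {C D : Submodule (ZMod 2) (Fin n → ZMod 2)} (h : C ≤ D) :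
    dualCode D ≤ dualCode C := fun _ hu c hc => hu c (h hc)

lemma wtCount_eq_zero {w : ℕ} (h : ∀ v ∈ C, hammingNorm v ≠ w) : wtCount C w = 0 := by
  rw [wtCount, Finset.card_eq_zero, Finset.filter_eq_empty_iff]
  intro v hv
  exact h v (mem_codewords.1 hv)

lemma ne_of_wtCount_eq_zero {w : ℕ} (h : wtCount C w = 0) {v : Fin n → ZMod 2} (hv : v ∈ C) :
    hammingNorm v ≠ w := by
  rw [wtCount, Finset.card_eq_zero, Finset.filter_eq_empty_iff] at h
  exact h (mem_codewords.2 hv)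

lemma wtCount_zero (C : Submodule (ZMod 2) (Fin n → ZMod 2)) : wtCount C 0 = 1 := by
  rw [wtCount, Finset.card_eq_one]
  refine ⟨0, ?_⟩
  ext v
  simp only [Finset.mem_filter, mem_codewords, hammingNorm_eq_zero, Finset.mem_singleton]
  constructor
  · exact fun h => h.2
  · rintro rfl; exact ⟨C.zero_mem, rfl⟩

lemma sum_wtCount_mul (C : Submodule (ZMod 2) (Fin n → ZMod 2)) (f : ℕ → ℤ) :
    ∑ w ∈ Finset.range (n + 1), wtCount C w * f w = ∑ c ∈ codewords C, f (hammingNorm c) := by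
  rw [← Finset.sum_fiberwise_of_maps_to (s := codewords C) (t := Finset.range (n + 1))
    (g := fun c => hammingNorm c)
    (fun c _ => Finset.mem_range.2 (Nat.lt_succ_of_le (hammingNorm_le c)))]
  refine Finset.sum_congr rfl fun w _ => ?_
  rw [Finset.sum_congr rfl (g := fun _ => f w)
    (fun c hc => by rw [(Finset.mem_filter.1 hc).2]), Finset.sum_const, wtCount, nsmul_eq_mul]

lemma sum_sgn_dotProduct_of_mem {u : Fin n → ZMod 2} (hu : u ∈ dualCode C) :
    ∑ c ∈ codewords C, sgn (u ⬝ᵥ c) = 2 ^ Module.finrank (ZMod 2) C := by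
  rw [Finset.sum_congr rfl (g := fun _ => 1)
    (fun c hc => by rw [hu c (mem_codewords.1 hc), sgn_zero]), Finset.sum_const, card_codewords]
  simp

lemma sum_sgn_dotProduct_of_notMem {u : Fin n → ZMod 2} (hu : u ∉ dualCode C) :
    ∑ c ∈ codewords C, sgn (u ⬝ᵥ c) = 0 := by
  rw [mem_dualCode] at hu
  push Not at hu
  obtain ⟨d, hd, hud⟩ := hu
  have hud' : u ⬝ᵥ d = 1 := (ZMod.two_eq_zero_or_one _).resolve_left hud
  have hmem : ∀ c ∈ codewords C, c + d ∈ codewords C := fun c hc =>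
    mem_codewords.2 (C.add_mem (mem_codewords.1 hc) hd)
  have hinv : ∀ c ∈ codewords C, c + d + d = c := fun c _ => by
    rw [add_assoc, add_self_word, add_zero]
  have h : ∑ c ∈ codewords C, sgn (u ⬝ᵥ c) = ∑ c ∈ codewords C, -sgn (u ⬝ᵥ c) :=
    Finset.sum_nbij' (· + d) (· + d) hmem hmem hinv hinv fun c _ => by
      rw [dotProduct_add, sgn_add, hud', sgn_one, mul_neg_one, neg_neg]
  rw [Finset.sum_neg_distrib] at h
  omega

/-- The Krawtchouk polynomial `K_j(w)` for length `n`. -/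
def krawtchouk (n j w : ℕ) : ℤ :=
  ∑ i ∈ Finset.range (j + 1), (-1) ^ i * (w.choose i : ℤ) * ((n - w).choose (j - i) : ℤ)

open Polynomial in
lemma coeff_one_sub_X_pow_mul (n j w : ℕ) :
    ((1 - X : ℤ[X]) ^ w * (1 + X) ^ (n - w)).coeff j = krawtchouk n j w := by
  rw [coeff_mul, Finset.Nat.sum_antidiagonal_eq_sum_range_succ_mk, krawtchouk]
  refine Finset.sum_congr rfl fun i _ => ?_
  have h : (1 - X : ℤ[X]) ^ w = ((1 + X : ℤ[X]) ^ w).comp (Polynomial.C (-1) * X) := by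
    simp [sub_eq_add_neg]
  rw [coeff_one_add_X_pow, h, comp_C_mul_X_coeff, coeff_one_add_X_pow, mul_comm ((w.choose i : ℕ) : ℤ)]

open Polynomial in
lemma sum_sgn_mul_X_pow (c : Fin n → ZMod 2) :
    ∑ u : Fin n → ZMod 2, Polynomial.C (sgn (u ⬝ᵥ c)) * (X : ℤ[X]) ^ hammingNorm u =
      (1 - X) ^ hammingNorm c * (1 + X) ^ (n - hammingNorm c) := by
  have h : ∀ u : Fin n → ZMod 2, Polynomial.C (sgn (u ⬝ᵥ c)) * (X : ℤ[X]) ^ hammingNorm u =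
      ∏ i, (Polynomial.C (sgn (u i * c i)) * if u i = 1 then X else 1) := by
    intro u
    rw [Finset.prod_mul_distrib, dotProduct, sgn_sum, map_prod, Finset.prod_ite,
      Finset.prod_const, Finset.prod_const_one, mul_one, hammingNorm_eq_card]
  simp only [h]
  rw [← Fintype.prod_sum fun i a => (Polynomial.C (sgn (a * c i)) * if a = 1 then (X : ℤ[X]) else 1)]
  have h2 : ∀ i, (∑ a : ZMod 2, (Polynomial.C (sgn (a * c i)) * if a = 1 then (X : ℤ[X]) else 1)) =
      if c i = 1 then 1 - X else 1 + X := by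
    intro i
    have : (Finset.univ : Finset (ZMod 2)) = {0, 1} := rfl
    rw [this, Finset.sum_pair (by decide)]
    rcases ZMod.two_eq_zero_or_one (c i) with h | h <;> simp [h, sub_eq_add_neg]
  simp only [h2]
  rw [Finset.prod_ite, Finset.prod_const, Finset.prod_const, ← hammingNorm_eq_card]
  congr 2
  have := Finset.card_filter_add_card_filter_not (s := (Finset.univ : Finset (Fin n)))
    (fun i => c i = 1)
  rw [← hammingNorm_eq_card, Finset.card_univ, Fintype.card_fin] at this
  omega

open Polynomial in
lemma sum_sgn_eq_krawtchouk (c : Fin n → ZMod 2) (j : ℕ) :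
    ∑ u ∈ Finset.univ.filter (fun u : Fin n → ZMod 2 => hammingNorm u = j), sgn (u ⬝ᵥ c) =
      krawtchouk n j (hammingNorm c) := by
  rw [← coeff_one_sub_X_pow_mul, ← sum_sgn_mul_X_pow, finsetSum_coeff, Finset.sum_filter]
  refine Finset.sum_congr rfl fun u _ => ?_
  rw [coeff_C_mul, coeff_X_pow]
  by_cases h : hammingNorm u = j
  · simp [h]
  · simp [h, Ne.symm h]

/-- The **MacWilliams identities**. -/
theorem sum_wtCount_mul_krawtchouk (C : Submodule (ZMod 2) (Fin n → ZMod 2)) (j : ℕ) :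
    ∑ w ∈ Finset.range (n + 1), wtCount C w * krawtchouk n j w =
      2 ^ Module.finrank (ZMod 2) C * wtCount (dualCode C) j := by
  classical
  rw [sum_wtCount_mul]
  simp only [← sum_sgn_eq_krawtchouk]
  rw [Finset.sum_comm]
  have h : ∀ u : Fin n → ZMod 2, ∑ c ∈ codewords C, sgn (u ⬝ᵥ c) =
      if u ∈ dualCode C then 2 ^ Module.finrank (ZMod 2) C else 0 := by
    intro u
    split_ifs with hu
    · exact sum_sgn_dotProduct_of_mem hu
    · exact sum_sgn_dotProduct_of_notMem hu
  simp only [h]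
  rw [← Finset.sum_filter, Finset.sum_const, wtCount, nsmul_eq_mul, mul_comm]
  congr 3
  ext u
  simp [and_comm]

end Codes

/-- Every nonzero codeword of `C` has weight at least `d`. -/
def MinWtGE {n : ℕ} (C : Submodule (ZMod 2) (Fin n → ZMod 2)) (d : ℕ) : Prop :=
  ∀ v ∈ C, v ≠ 0 → d ≤ hammingNorm v

lemma MinWtGE.wtCount_eq_zero {n d : ℕ} {C : Submodule (ZMod 2) (Fin n → ZMod 2)}
    (hC : MinWtGE C d) {w : ℕ} (h0 : 0 < w) (hw : w < d) : wtCount C w = 0 := by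
  refine _root_.wtCount_eq_zero fun v hv h => ?_
  have := hC v hv (by rintro rfl; rw [hammingNorm_zero] at h; omega)
  omega

lemma macWilliams_zero (C : Submodule (ZMod 2) (Fin 16 → ZMod 2)) :
    (1 * wtCount C 0 + 1 * wtCount C 1 + 1 * wtCount C 2 + 1 * wtCount C 3 + 1 * wtCount C 4 + 1 *
      wtCount C 5 + 1 * wtCount C 6 + 1 * wtCount C 7 + 1 * wtCount C 8 + 1 * wtCount C 9 + 1 *
      wtCount C 10 + 1 * wtCount C 11 + 1 * wtCount C 12 + 1 * wtCount C 13 + 1 * wtCount C 14 + 1 *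
      wtCount C 15 + 1 * wtCount C 16 : ℤ) =
      2 ^ Module.finrank (ZMod 2) C * wtCount (dualCode C) 0 := by
  rw [← sum_wtCount_mul_krawtchouk]
  norm_num [Finset.sum_range_succ, krawtchouk, Nat.choose]

lemma macWilliams_one (C : Submodule (ZMod 2) (Fin 16 → ZMod 2)) :
    (16 * wtCount C 0 + 14 * wtCount C 1 + 12 * wtCount C 2 + 10 * wtCount C 3 + 8 * wtCount C 4 + 6
      * wtCount C 5 + 4 * wtCount C 6 + 2 * wtCount C 7 + (-2) * wtCount C 9 + (-4) * wtCount C 10 +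
      (-6) * wtCount C 11 + (-8) * wtCount C 12 + (-10) * wtCount C 13 + (-12) * wtCount C 14 +
      (-14) * wtCount C 15 + (-16) * wtCount C 16 : ℤ) =
      2 ^ Module.finrank (ZMod 2) C * wtCount (dualCode C) 1 := by
  rw [← sum_wtCount_mul_krawtchouk]
  norm_num [Finset.sum_range_succ, krawtchouk, Nat.choose]
  ring

lemma macWilliams_two (C : Submodule (ZMod 2) (Fin 16 → ZMod 2)) :
    (120 * wtCount C 0 + 90 * wtCount C 1 + 64 * wtCount C 2 + 42 * wtCount C 3 + 24 * wtCount C 4 +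
      10 * wtCount C 5 + (-6) * wtCount C 7 + (-8) * wtCount C 8 + (-6) * wtCount C 9 + 10 * wtCount
      C 11 + 24 * wtCount C 12 + 42 * wtCount C 13 + 64 * wtCount C 14 + 90 * wtCount C 15 + 120 *
      wtCount C 16 : ℤ) =
      2 ^ Module.finrank (ZMod 2) C * wtCount (dualCode C) 2 := by
  rw [← sum_wtCount_mul_krawtchouk]
  norm_num [Finset.sum_range_succ, krawtchouk, Nat.choose]
  ring

lemma macWilliams_three (C : Submodule (ZMod 2) (Fin 16 → ZMod 2)) :
    (560 * wtCount C 0 + 350 * wtCount C 1 + 196 * wtCount C 2 + 90 * wtCount C 3 + 24 * wtCount C 4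
      + (-10) * wtCount C 5 + (-20) * wtCount C 6 + (-14) * wtCount C 7 + 14 * wtCount C 9 + 20 *
      wtCount C 10 + 10 * wtCount C 11 + (-24) * wtCount C 12 + (-90) * wtCount C 13 + (-196) *
      wtCount C 14 + (-350) * wtCount C 15 + (-560) * wtCount C 16 : ℤ) =
      2 ^ Module.finrank (ZMod 2) C * wtCount (dualCode C) 3 := by
  rw [← sum_wtCount_mul_krawtchouk]
  norm_num [Finset.sum_range_succ, krawtchouk, Nat.choose]
  ring

lemma macWilliams_five (C : Submodule (ZMod 2) (Fin 16 → ZMod 2)) :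
    (4368 * wtCount C 0 + 1638 * wtCount C 1 + 364 * wtCount C 2 + (-78) * wtCount C 3 + (-120) *
      wtCount C 4 + (-34) * wtCount C 5 + 36 * wtCount C 6 + 42 * wtCount C 7 + (-42) * wtCount C 9
      + (-36) * wtCount C 10 + 34 * wtCount C 11 + 120 * wtCount C 12 + 78 * wtCount C 13 + (-364) *
      wtCount C 14 + (-1638) * wtCount C 15 + (-4368) * wtCount C 16 : ℤ) =
      2 ^ Module.finrank (ZMod 2) C * wtCount (dualCode C) 5 := by
  rw [← sum_wtCount_mul_krawtchouk]
  norm_num [Finset.sum_range_succ, krawtchouk, Nat.choose]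
  ring

lemma macWilliams_fifteen (C : Submodule (ZMod 2) (Fin 16 → ZMod 2)) :
    (16 * wtCount C 0 + (-14) * wtCount C 1 + 12 * wtCount C 2 + (-10) * wtCount C 3 + 8 * wtCount C
      4 + (-6) * wtCount C 5 + 4 * wtCount C 6 + (-2) * wtCount C 7 + 2 * wtCount C 9 + (-4) *
      wtCount C 10 + 6 * wtCount C 11 + (-8) * wtCount C 12 + 10 * wtCount C 13 + (-12) * wtCount C
      14 + 14 * wtCount C 15 + (-16) * wtCount C 16 : ℤ) =
      2 ^ Module.finrank (ZMod 2) C * wtCount (dualCode C) 15 := by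
  rw [← sum_wtCount_mul_krawtchouk]
  norm_num [Finset.sum_range_succ, krawtchouk, Nat.choose]
  ring

lemma macWilliams_sixteen (C : Submodule (ZMod 2) (Fin 16 → ZMod 2)) :
    (1 * wtCount C 0 + (-1) * wtCount C 1 + 1 * wtCount C 2 + (-1) * wtCount C 3 + 1 * wtCount C 4 +
      (-1) * wtCount C 5 + 1 * wtCount C 6 + (-1) * wtCount C 7 + 1 * wtCount C 8 + (-1) * wtCount C
      9 + 1 * wtCount C 10 + (-1) * wtCount C 11 + 1 * wtCount C 12 + (-1) * wtCount C 13 + 1 *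
      wtCount C 14 + (-1) * wtCount C 15 + 1 * wtCount C 16 : ℤ) =
      2 ^ Module.finrank (ZMod 2) C * wtCount (dualCode C) 16 := by
  rw [← sum_wtCount_mul_krawtchouk]
  norm_num [Finset.sum_range_succ, krawtchouk, Nat.choose]

/-- If translates of `C` by the words `f a` are disjoint, then there are at most
`2 ^ n / |C|` of them. -/
lemma packing_bound {n : ℕ} (C : Submodule (ZMod 2) (Fin n → ZMod 2)) {α : Type*} [Fintype α]
    (f : α → Fin n → ZMod 2) (hf : ∀ a b, f a + f b ∈ C → a = b) :
    2 ^ Module.finrank (ZMod 2) C * Fintype.card α ≤ 2 ^ n := by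
  classical
  have hinj : Function.Injective fun x : C × α => (x.1 : Fin n → ZMod 2) + f x.2 := by
    rintro ⟨c, a⟩ ⟨d, b⟩ h
    have h : (c : Fin n → ZMod 2) + f a = d + f b := h
    have hab : f a + f b = c + d := by
      have h2 := add_self_word (c : Fin n → ZMod 2)
      have h3 := add_self_word (f b)
      calc f a + f b = (c + c) + f a + f b := by rw [h2, zero_add]
        _ = c + (c + f a) + f b := by abel
        _ = c + d + (f b + f b) := by rw [h]; abel
        _ = c + d := by rw [h3, add_zero]
    have h1 : a = b := hf a b (by rw [hab]; exact C.add_mem c.2 d.2)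
    subst h1
    simpa using h
  have h1 := Fintype.card_le_of_injective _ hinj
  have h2 := Module.card_eq_pow_finrank (K := ZMod 2) (V := C)
  rwa [Fintype.card_prod, h2, ZMod.card, Fintype.card_fun, ZMod.card, Fintype.card_fin] at h1

lemma hammingNorm_add_le {n : ℕ} (u v : Fin n → ZMod 2) :
    hammingNorm (u + v) ≤ hammingNorm u + hammingNorm v := by
  have := hammingNorm_add_add u v
  omega

/-- The sphere-packing bound, for a set `T` of words of weight at most `t`. -/
lemma sphere_packing {n d t : ℕ} {C : Submodule (ZMod 2) (Fin n → ZMod 2)} (hC : MinWtGE C d)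
    (ht : 2 * t < d) (T : Finset (Fin n → ZMod 2)) (hT : ∀ v ∈ T, hammingNorm v ≤ t) :
    2 ^ Module.finrank (ZMod 2) C * T.card ≤ 2 ^ n := by
  have h := packing_bound C (fun v : T => (v : Fin n → ZMod 2)) fun a b hab => by
    by_contra hne
    have h1 : (a : Fin n → ZMod 2) + b ≠ 0 := fun h0 => hne <| Subtype.ext <| by
      have h3 := add_self_word (b : Fin n → ZMod 2)
      calc (a : Fin n → ZMod 2) = a + (b + b) := by rw [h3, add_zero]
        _ = b := by rw [← add_assoc, h0, zero_add]
    have h2 := hC _ hab h1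
    have h3 := hammingNorm_add_le (a : Fin n → ZMod 2) b
    have h4 := hT a a.2
    have h5 := hT b b.2
    omega
  simpa using h

lemma card_hammingNorm_eq (n j : ℕ) :
    ((Finset.univ.filter fun u : Fin n → ZMod 2 => hammingNorm u = j).card : ℤ) =
      krawtchouk n j 0 := by
  have h := sum_sgn_eq_krawtchouk (0 : Fin n → ZMod 2) j
  simpa using h

lemma krawtchouk_zero_right (n j : ℕ) : krawtchouk n j 0 = n.choose j := by
  rw [krawtchouk, Finset.sum_eq_single 0]
  · simp
  · intro i _ hi
    simp [Nat.choose_eq_zero_of_lt (Nat.pos_of_ne_zero hi)]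
  · simp

lemma card_hammingNorm_le (n t : ℕ) :
    (Finset.univ.filter fun u : Fin n → ZMod 2 => hammingNorm u ≤ t).card =
      ∑ j ∈ Finset.range (t + 1), n.choose j := by
  rw [Finset.card_eq_sum_card_fiberwise (f := fun u => hammingNorm u)
    (t := Finset.range (t + 1)) (fun u hu => by
      have : hammingNorm u ≤ t := by simpa using hu
      simpa [Nat.lt_succ_iff] using this)]
  refine Finset.sum_congr rfl fun j hj => ?_
  have h := card_hammingNorm_eq n j
  rw [krawtchouk_zero_right] at h
  rw [Finset.filter_filter, ← Nat.cast_inj (R := ℤ), ← h]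
  congr 2
  ext u
  have := Finset.mem_range.1 hj
  simp only [Finset.mem_filter, Finset.mem_univ, true_and]
  omega

lemma hamming_bound {n d t : ℕ} {C : Submodule (ZMod 2) (Fin n → ZMod 2)} (hC : MinWtGE C d)
    (ht : 2 * t < d) :
    2 ^ Module.finrank (ZMod 2) C * ∑ j ∈ Finset.range (t + 1), n.choose j ≤ 2 ^ n := by
  rw [← card_hammingNorm_le]
  exact sphere_packing hC ht _ fun v hv => (Finset.mem_filter.1 hv).2

lemma MinWtGE.mono {n d e : ℕ} {C : Submodule (ZMod 2) (Fin n → ZMod 2)} (hC : MinWtGE C d)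
    (h : e ≤ d) : MinWtGE C e := fun v hv h0 => h.trans (hC v hv h0)

section Bounds

variable {C : Submodule (ZMod 2) (Fin 16 → ZMod 2)}

lemma not_minWtGE_of_finrank_twelve (hk : Module.finrank (ZMod 2) C = 12) : ¬ MinWtGE C 3 := by
  intro hC
  have h := hamming_bound hC (t := 1) (by norm_num)
  rw [hk] at h
  revert h
  decide

lemma not_minWtGE_of_finrank_nine (hk : Module.finrank (ZMod 2) C = 9) : ¬ MinWtGE C 5 := by
  intro hC
  have h := hamming_bound hC (t := 2) (by norm_num)
  rw [hk] at h
  revert h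
  decide

lemma not_minWtGE_of_finrank_six (hk : Module.finrank (ZMod 2) C = 6) : ¬ MinWtGE C 7 := by
  intro hC
  have h0 := macWilliams_zero C
  have h1 := macWilliams_one C
  have h2 := macWilliams_two C
  have h3 := macWilliams_three C
  have h16 := macWilliams_sixteen C
  norm_num [hk, wtCount_zero, hC.wtCount_eq_zero] at h0 h1 h2 h3 h16
  linarith

lemma not_minWtGE_of_finrank_three (hk : Module.finrank (ZMod 2) C = 3) : ¬ MinWtGE C 9 := by
  intro hC
  have h0 := macWilliams_zero C
  have h1 := macWilliams_one C
  have h16 := macWilliams_sixteen C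
  norm_num [hk, wtCount_zero, hC.wtCount_eq_zero] at h0 h1 h16
  linarith

lemma not_minWtGE_eight_of_finrank_eight (hk : Module.finrank (ZMod 2) C = 8) :
    ¬ MinWtGE C 8 := by
  intro hC
  have h0 := macWilliams_zero C
  have h1 := macWilliams_one C
  have h2 := macWilliams_two C
  norm_num [hk, wtCount_zero, hC.wtCount_eq_zero] at h0 h1 h2
  linarith

/-- The weight distribution of a `[16, 5, 8]` code and the low part of that of its dual. -/
lemma wtCount_of_finrank_five (hk : Module.finrank (ZMod 2) C = 5) (hC : MinWtGE C 8) :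
    wtCount C 8 = 30 ∧ wtCount C 16 = 1 ∧ wtCount (dualCode C) 1 = 0 ∧
      wtCount (dualCode C) 2 = 0 := by
  have h0 := macWilliams_zero C
  have h1 := macWilliams_one C
  have h2 := macWilliams_two C
  norm_num [hk, wtCount_zero, hC.wtCount_eq_zero] at h0 h1 h2
  omega

end Bounds

lemma hammingNorm_single {n : ℕ} (p : Fin n) :
    hammingNorm (Pi.single p 1 : Fin n → ZMod 2) = 1 := by
  have h := hammingNorm_add_single (0 : Fin n → ZMod 2) p
  simpa using h

section Shortened

variable {n : ℕ} (c : Fin n → ZMod 2) (s : Fin n)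

/-- Extension by zero of a word on the support of `c`, with the coordinate `s` deleted. -/
def extendSupport (x : {i // c i = 1 ∧ i ≠ s} → ZMod 2) : Fin n → ZMod 2 :=
  fun i => if h : c i = 1 ∧ i ≠ s then x ⟨i, h⟩ else 0

/-- The zero word or a word of weight one off the support of `c`. -/
def singleOff (o : Option {i // c i = 0}) : Fin n → ZMod 2 :=
  o.elim 0 fun i => Pi.single i.1 1

variable {c s}

lemma extendSupport_apply (x : {i // c i = 1 ∧ i ≠ s} → ZMod 2)
    (i : {i // c i = 1 ∧ i ≠ s}) : extendSupport c s x i = x i := by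
  simp [extendSupport, i.2]

lemma extendSupport_self (x : {i // c i = 1 ∧ i ≠ s} → ZMod 2) : extendSupport c s x s = 0 := by
  simp [extendSupport]

lemma extendSupport_mul (x : {i // c i = 1 ∧ i ≠ s} → ZMod 2) :
    extendSupport c s x * (1 + c) = 0 := by
  funext i
  by_cases h : c i = 1
  · simp [h, CharTwo.add_self_eq_zero]
  · simp [extendSupport, h]

lemma singleOff_apply (o : Option {i // c i = 0}) {i : Fin n} (h : c i = 1) :
    singleOff c o i = 0 := by
  cases o with
  | none => rfl
  | some j =>
    have : i ≠ j := by rintro rfl; simp [j.2] at h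
    simp [singleOff, this]

lemma singleOff_mul (o : Option {i // c i = 0}) : singleOff c o * (1 + c) = singleOff c o := by
  funext i
  rcases ZMod.two_eq_zero_or_one (c i) with h | h
  · simp [h]
  · simp [singleOff_apply o h]

lemma hammingNorm_singleOff_le (o : Option {i // c i = 0}) : hammingNorm (singleOff c o) ≤ 1 := by
  cases o with
  | none => simp [singleOff]
  | some j => exact (hammingNorm_single j.1).le

lemma singleOff_injective : Function.Injective (singleOff c) := by
  have h0 : ∀ j : {i // c i = 0}, singleOff c (some j) j = 1 := fun j => by simp [singleOff]
  rintro (_ | i) (_ | j) h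
  · rfl
  · have := congrFun h j
    rw [h0] at this
    simp [singleOff] at this
  · have := congrFun h i
    rw [h0] at this
    simp [singleOff] at this
  · replace h := congrFun h i
    rw [h0] at h
    by_cases hij : i = j
    · rw [hij]
    · have : i.1 ≠ j.1 := fun h => hij (Subtype.ext h)
      simp [singleOff, Pi.single_eq_of_ne this] at h

/-- The packing bound for the words which off the support of a codeword `c` have weight at
most one. -/
lemma residual_packing {C : Submodule (ZMod 2) (Fin n → ZMod 2)} {d : ℕ} (hC : MinWtGE C d)
    (hc : c ∈ C) (hd : hammingNorm c + 4 < 2 * d) (h0 : c ≠ 0) :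
    2 ^ Module.finrank (ZMod 2) C * (2 ^ (hammingNorm c - 1) * (n - hammingNorm c + 1)) ≤
      2 ^ n := by
  obtain ⟨s, hs⟩ : ∃ s, c s = 1 := by
    obtain ⟨s, hs⟩ := Function.ne_iff.1 h0
    exact ⟨s, (ZMod.two_eq_zero_or_one _).resolve_left hs⟩
  have h := packing_bound C
    (fun a : ({i // c i = 1 ∧ i ≠ s} → ZMod 2) × Option {i // c i = 0} =>
      extendSupport c s a.1 + singleOff c a.2) (by
    rintro ⟨x, o⟩ ⟨y, p⟩ hz
    dsimp only at hz
    set z := extendSupport c s x + singleOff c o + (extendSupport c s y + singleOff c p) with hzd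
    have hzs : z s = 0 := by
      simp [hzd, extendSupport_self, singleOff_apply _ hs]
    have hzm : z * (1 + c) = singleOff c o + singleOff c p := by
      simp only [hzd, add_mul, extendSupport_mul, singleOff_mul, zero_add]
    have hzw : hammingNorm z ≤ hammingNorm (z * c) + 2 := by
      have h1 : z = z * c + z * (1 + c) := by
        rw [mul_add, mul_one, add_comm z, ← add_assoc, add_self_word, zero_add]
      have h2 := hammingNorm_add_le (z * c) (z * (1 + c))
      have h3 := hammingNorm_add_le (singleOff c o) (singleOff c p)
      have h4 := hammingNorm_singleOff_le o
      have h5 := hammingNorm_singleOff_le p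
      rw [← h1, hzm] at h2
      omega
    have hzc := hammingNorm_add_add z c
    have hz0 : z = 0 := by
      by_contra hz0
      have h1 := hC z hz hz0
      have h2 := hC (z + c) (C.add_mem hz hc) fun h => by
        have := congrFun h s
        simp [hzs, hs] at this
      omega
    rw [hz0, zero_mul] at hzm
    have hop : o = p := singleOff_injective <| by
      rw [← add_zero (singleOff c o), ← add_self_word (singleOff c p), ← add_assoc, ← hzm,
        zero_add]
    have hxy : x = y := by
      funext i
      have h1 := congrFun hz0 i
      simp only [hzd, Pi.add_apply, extendSupport_apply, singleOff_apply _ i.2.1, Pi.zero_apply,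
        add_zero] at h1
      exact CharTwo.add_eq_zero.1 h1
    rw [hop, hxy])
  have hcard : Fintype.card {i // c i = 1} = hammingNorm c := by
    rw [hammingNorm_eq_card, Fintype.card_subtype]
  have h1 : Fintype.card {i // c i = 1 ∧ i ≠ s} = hammingNorm c - 1 := by
    rw [hammingNorm_eq_card, Fintype.card_subtype, Finset.filter_and, Finset.filter_ne',
      Finset.inter_erase, Finset.inter_univ, Finset.card_erase_of_mem (by simp [hs])]
  have h2 : Fintype.card {i // c i = 0} = n - hammingNorm c := by
    have h3 := Fintype.card_subtype_compl fun i => c i = 1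
    rw [Fintype.card_fin, hcard] at h3
    rw [← h3]
    refine Fintype.card_congr (Equiv.subtypeEquivRight fun i => ?_)
    rcases ZMod.two_eq_zero_or_one (c i) with h | h <;> simp [h]
  rwa [Fintype.card_prod, Fintype.card_fun, ZMod.card, h1, Fintype.card_option, h2] at h

end Shortened

lemma not_minWtGE_of_finrank_eight {C : Submodule (ZMod 2) (Fin 16 → ZMod 2)}
    (hk : Module.finrank (ZMod 2) C = 8) : ¬ MinWtGE C 6 := by
  intro hC
  refine not_minWtGE_eight_of_finrank_eight hk fun c hc h0 => ?_
  by_contra hlt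
  have h6 := hC c hc h0
  have h := residual_packing hC hc (by omega) h0
  have hw : hammingNorm c = 6 ∨ hammingNorm c = 7 := by omega
  rcases hw with hw | hw <;> rw [hw, hk] at h <;> revert h <;> decide

section FirstOrderReedMuller

variable {R : Submodule (ZMod 2) (Fin 16 → ZMod 2)}

lemma eq_or_of_finrank_five (hk : Module.finrank (ZMod 2) R = 5) (hR : MinWtGE R 8)
    {r : Fin 16 → ZMod 2} (hr : r ∈ R) : r = 0 ∨ hammingNorm r = 8 ∨ r = 1 := by
  by_cases h0 : r = 0
  · exact .inl h0
  refine .inr ?_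
  by_contra! h
  have h8 := hR r hr h0
  have h16 := hammingNorm_le r
  have hne : hammingNorm r ≠ 16 := fun h1 => h.2 (eq_one_of_hammingNorm_eq h1)
  have hpos : wtCount R (hammingNorm r) ≠ 0 := fun h1 => ne_of_wtCount_eq_zero h1 hr rfl
  have h1 := macWilliams_zero R
  have h2 := wtCount_of_finrank_five hk hR
  norm_num [hk, wtCount_zero, hR.wtCount_eq_zero, h2.1, h2.2.1] at h1
  generalize hammingNorm r = w at *
  have h3 := h.1
  interval_cases w <;> omega

lemma one_mem_of_finrank_five (hk : Module.finrank (ZMod 2) R = 5) (hR : MinWtGE R 8) :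
    (1 : Fin 16 → ZMod 2) ∈ R := by
  have h := (wtCount_of_finrank_five hk hR).2.1
  have h1 : ¬ ∀ v ∈ R, hammingNorm v ≠ 16 := fun h1 => by
    rw [wtCount_eq_zero h1] at h
    omega
  push Not at h1
  obtain ⟨v, hv, h2⟩ := h1
  rwa [← eq_one_of_hammingNorm_eq h2]

lemma sum_sgn_single_mul (hk : Module.finrank (ZMod 2) R = 5) (hR : MinWtGE R 8)
    (i j : Fin 16) :
    ∑ r ∈ codewords R, sgn (r i) * sgn (r j) = if i = j then 32 else 0 := by
  have h : ∀ r : Fin 16 → ZMod 2,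
      sgn (r i) * sgn (r j) = sgn ((Pi.single i 1 + Pi.single j 1) ⬝ᵥ r) := fun r => by
    rw [add_dotProduct, single_one_dotProduct, single_one_dotProduct, sgn_add]
  simp only [h]
  split_ifs with hij
  · subst hij
    rw [sum_sgn_dotProduct_of_mem, hk]
    · norm_num
    · rw [add_self_word]
      exact zero_mem _
  · refine sum_sgn_dotProduct_of_notMem fun hmem => ?_
    refine ne_of_wtCount_eq_zero (wtCount_of_finrank_five hk hR).2.2.2 hmem ?_
    have h1 := hammingNorm_add_single (Pi.single i 1 : Fin 16 → ZMod 2) j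
    rw [hammingNorm_single, Pi.single_eq_of_ne (Ne.symm hij)] at h1
    norm_num at h1
    exact_mod_cast h1

lemma sum_linear_mul_linear (hk : Module.finrank (ZMod 2) R = 5) (hR : MinWtGE R 8)
    (a b : Fin 16 → ℤ) :
    ∑ r ∈ codewords R, (∑ i, a i * sgn (r i)) * (∑ i, b i * sgn (r i)) =
      32 * ∑ i, a i * b i := by
  calc ∑ r ∈ codewords R, (∑ i, a i * sgn (r i)) * (∑ i, b i * sgn (r i))
      = ∑ r ∈ codewords R, ∑ i, ∑ j, a i * b j * (sgn (r i) * sgn (r j)) := by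
        refine Finset.sum_congr rfl fun r _ => ?_
        rw [Finset.sum_mul_sum]
        refine Finset.sum_congr rfl fun i _ => Finset.sum_congr rfl fun j _ => ?_
        ring
    _ = ∑ i, ∑ j, a i * b j * ∑ r ∈ codewords R, sgn (r i) * sgn (r j) := by
        rw [Finset.sum_comm]
        refine Finset.sum_congr rfl fun i _ => ?_
        rw [Finset.sum_comm]
        exact Finset.sum_congr rfl fun j _ => (Finset.mul_sum _ _ _).symm
    _ = 32 * ∑ i, a i * b i := by
        simp only [sum_sgn_single_mul hk hR, mul_ite, mul_zero, Finset.sum_ite_eq,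
          Finset.mem_univ, if_true, Finset.mul_sum]
        exact Finset.sum_congr rfl fun i _ => by ring

lemma hammingNorm_add_eq_sum {n : ℕ} (u r : Fin n → ZMod 2) :
    (hammingNorm (u + r) : ℤ) =
      hammingNorm r + ∑ i, (if u i = 1 then 1 else 0) * sgn (r i) := by
  have h : ∀ i, sgn ((u + r) i) =
      sgn (r i) - 2 * ((if u i = 1 then 1 else 0) * sgn (r i)) := by
    intro i
    rw [Pi.add_apply, sgn_add]
    rcases ZMod.two_eq_zero_or_one (u i) with h | h <;> simp [h]
    ring
  have h1 := sum_sgn (u + r)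
  simp only [h, Finset.sum_sub_distrib, ← Finset.mul_sum, sum_sgn] at h1
  linarith

variable {C : Submodule (ZMod 2) (Fin 16 → ZMod 2)}

lemma dotProduct_eq_zero_iff_even {n : ℕ} (u v : Fin n → ZMod 2) :
    u ⬝ᵥ v = 0 ↔ Even (hammingNorm (u * v)) := by
  rw [dotProduct_eq_hammingNorm_mul, ZMod.natCast_eq_zero_iff_even]

lemma hammingNorm_of_finrank_five (hk : Module.finrank (ZMod 2) R = 5) (hR : MinWtGE R 8)
    {r : Fin 16 → ZMod 2} (hr : r ∈ R) :
    hammingNorm r = 0 ∨ hammingNorm r = 8 ∨ hammingNorm r = 16 := by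
  rcases eq_or_of_finrank_five hk hR hr with h | h | h
  · exact .inl (by rw [h, hammingNorm_zero])
  · exact .inr (.inl h)
  · refine .inr (.inr ?_)
    have := hammingNorm_add_one (0 : Fin 16 → ZMod 2)
    rw [zero_add, hammingNorm_zero] at this
    rw [h]
    exact this

/-- Even codewords of a code of minimum distance five containing `R` are orthogonal to `R`. -/
lemma mem_dualCode_of_even (hk : Module.finrank (ZMod 2) R = 5) (hR : MinWtGE R 8)
    (hRC : R ≤ C) (hC : MinWtGE C 5) {q : Fin 16 → ZMod 2} (hq : q ∈ C)
    (heven : Even (hammingNorm q)) : q ∈ dualCode R := by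
  intro r hr
  rw [dotProduct_eq_zero_iff_even]
  have hadd := hammingNorm_add_add q r
  have hr8 := hammingNorm_of_finrank_five hk hR hr
  by_cases hqR : q ∈ R
  · have hq8 := hammingNorm_of_finrank_five hk hR hqR
    have hqr8 := hammingNorm_of_finrank_five hk hR (R.add_mem hqR hr)
    rw [Nat.even_iff]
    omega
  have hone := one_mem_of_finrank_five hk hR
  have hbound : ∀ t ∈ R, hammingNorm (q + t) = 6 ∨ hammingNorm (q + t) = 8 ∨
      hammingNorm (q + t) = 10 := by
    have h1 : ∀ t ∈ R, 5 ≤ hammingNorm (q + t) := fun t ht =>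
      hC _ (C.add_mem hq (hRC ht)) fun h0 => hqR <| by
        rwa [← add_zero q, ← add_self_word t, ← add_assoc, h0, zero_add]
    intro t ht
    have h2 := h1 t ht
    have h3 := h1 _ (R.add_mem ht hone)
    have h4 := hammingNorm_add_one (q + t)
    have h5 := hammingNorm_add_add q t
    have h6 := hammingNorm_of_finrank_five hk hR ht
    rw [← add_assoc] at h3
    rw [Nat.even_iff] at heven
    omega
  have hle : ∀ t ∈ codewords R, ((16 : ℤ) - 2 * hammingNorm (q + t)) ^ 2 ≤ 16 := fun t ht => by
    rw [mem_codewords] at ht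
    rcases hbound t ht with h | h | h <;> rw [h] <;> norm_num
  have hsum : ∑ t ∈ codewords R, ((16 : ℤ) - 2 * hammingNorm (q + t)) ^ 2 =
      ∑ t ∈ codewords R, 16 := by
    have h1 := sum_linear_mul_linear hk hR (fun i => sgn (q i)) fun i => sgn (q i)
    simp only [sgn_mul_self] at h1
    simp only [← sgn_add, ← Pi.add_apply, sum_sgn, ← sq] at h1
    rw [Finset.sum_const, card_codewords, hk]
    simpa using h1
  have heq := (Finset.sum_eq_sum_iff_of_le hle).1 hsum
  have h6 : ∀ t ∈ R, hammingNorm (q + t) = 6 ∨ hammingNorm (q + t) = 10 := fun t ht => by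
    have h1 := heq t (by rwa [mem_codewords])
    rcases hbound t ht with h | h | h
    · exact .inl h
    · rw [h] at h1
      norm_num at h1
    · exact .inr h
  have h7 := h6 r hr
  have h8 := h6 0 R.zero_mem
  rw [add_zero] at h8
  rw [Nat.even_iff]
  omega

/-- An odd word agrees on `R` with a coordinate function. -/
lemma exists_add_single_mem_dualCode (hk : Module.finrank (ZMod 2) R = 5) (hR : MinWtGE R 8)
    {f : Fin 16 → ZMod 2} (hodd : ¬ Even (hammingNorm f)) :
    ∃ p, f + Pi.single p 1 ∈ dualCode R := by
  by_contra! h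
  have h1 : ∑ p, ∑ r ∈ codewords R, sgn ((f + Pi.single p 1) ⬝ᵥ r) = 0 :=
    Finset.sum_eq_zero fun p _ => sum_sgn_dotProduct_of_notMem (h p)
  rw [Finset.sum_comm] at h1
  have hf : sgn (f ⬝ᵥ 1) = -1 := by
    have h2 : f ⬝ᵥ 1 ≠ 0 := by
      rwa [Ne, dotProduct_eq_zero_iff_even, mul_one]
    simp [sgn, h2]
  have h2 : ∀ r ∈ codewords R, ∑ p, sgn ((f + Pi.single p 1) ⬝ᵥ r) =
      (if r = 0 then 16 else 0) + if r = 1 then 16 else 0 := by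
    intro r hr
    simp only [add_dotProduct, single_one_dotProduct, sgn_add, ← Finset.mul_sum, sum_sgn]
    rw [mem_codewords] at hr
    rcases eq_or_of_finrank_five hk hR hr with h | h | h
    · simp [h]
    · have h0 : r ≠ 0 := by rintro rfl; simp at h
      have h3 : r ≠ 1 := by
        rintro rfl
        have := hammingNorm_add_one (1 : Fin 16 → ZMod 2)
        rw [add_self_word, hammingNorm_zero] at this
        omega
      simp [h, h0, h3]
    · have := hammingNorm_add_one (1 : Fin 16 → ZMod 2)
      rw [add_self_word, hammingNorm_zero, zero_add] at this
      rw [h, hf, this]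
      simp
  rw [Finset.sum_congr rfl h2, Finset.sum_add_distrib, Finset.sum_ite_eq', Finset.sum_ite_eq',
    if_pos (by rw [mem_codewords]; exact R.zero_mem),
    if_pos (by rw [mem_codewords]; exact one_mem_of_finrank_five hk hR)] at h1
  norm_num at h1

lemma apply_eq_zero_of_hammingNorm_eq_five (hk : Module.finrank (ZMod 2) R = 5)
    (hR : MinWtGE R 8) (hRC : R ≤ C) (hC : MinWtGE C 5) {f : Fin 16 → ZMod 2} {p : Fin 16}
    (hf : f ∈ C) (hf5 : hammingNorm f = 5) (hp : f + Pi.single p 1 ∈ dualCode R) :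
    f p = 0 := by
  by_contra h0
  have hfp : f p = 1 := (ZMod.two_eq_zero_or_one _).resolve_left h0
  set u := f + Pi.single p 1 with hu
  have hup : u p = 0 := by simp [hu, hfp, CharTwo.add_self_eq_zero]
  have hu4 : hammingNorm u = 4 := by
    have := hammingNorm_add_single f p
    rw [hfp, sgn_one, hf5, ← hu] at this
    omega
  have hfu : f = u + Pi.single p 1 := by
    rw [hu, add_assoc, add_self_word, add_zero]
  have hone := hRC (one_mem_of_finrank_five hk hR)
  have h16 := hammingNorm_add_one (1 : Fin 16 → ZMod 2)
  rw [add_self_word, hammingNorm_zero, zero_add] at h16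
  set a : Fin 16 → ℤ := fun i => if u i = 1 then 1 else 0 with ha
  have hap : a p = 0 := by simp [ha, hup]
  have hg : ∀ r, ∑ i, a i * sgn (r i) = (hammingNorm (u + r) : ℤ) - hammingNorm r := fun r => by
    rw [hammingNorm_add_eq_sum]
    ring
  have hsq := sum_linear_mul_linear hk hR a a
  have hlin := sum_linear_mul_linear hk hR a (Pi.single p 1)
  have hb : ∀ r : Fin 16 → ZMod 2,
      ∑ i, (Pi.single p 1 : Fin 16 → ℤ) i * sgn (r i) = sgn (r p) := fun r => by
    simp [Pi.single_apply]
  have haa : ∑ i, a i * a i = 4 := by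
    have h1 : ∀ i, a i * a i = if u i = 1 then 1 else 0 := fun i => by
      simp only [ha]
      split_ifs <;> rfl
    simp only [h1, Finset.sum_boole]
    rw [← hammingNorm_eq_card, hu4]
    rfl
  have hab : ∑ i, a i * (Pi.single p 1 : Fin 16 → ℤ) i = 0 := by
    simp [Pi.single_apply, hap]
  simp only [hg, hb, haa, hab] at hsq hlin
  have hle : ∀ r ∈ codewords R,
      ((hammingNorm (u + r) : ℤ) - hammingNorm r) * ((hammingNorm (u + r) : ℤ) - hammingNorm r) +
        4 * (((hammingNorm (u + r) : ℤ) - hammingNorm r) * sgn (r p)) ≤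
      (if r = 0 then 32 else 0) + if r = 1 then 32 else 0 := by
    intro r hr
    rw [mem_codewords] at hr
    rcases eq_or_of_finrank_five hk hR hr with h | h | h
    · simp [h, hu4]
    · have h1 := hammingNorm_add_single (u + r) p
      have h2 : u + r + Pi.single p 1 = f + r := by rw [hfu]; abel
      rw [h2, Pi.add_apply, hup, zero_add] at h1
      have h3 := hC (f + r) (C.add_mem hf (hRC hr)) fun h3 => by
        have h5 : f = r := by
          rw [← add_zero f, ← add_self_word r, ← add_assoc, h3, zero_add]
        rw [h5] at hf5
        omega
      have h4 := hC (f + r + 1) (C.add_mem (C.add_mem hf (hRC hr)) hone) fun h4 => by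
        have h5 := hammingNorm_add_one (f + r)
        have h6 := hammingNorm_add_add f r
        rw [h4, hammingNorm_zero] at h5
        omega
      have h5 := hammingNorm_add_one (f + r)
      have h6 := (dotProduct_eq_zero_iff_even u r).1 (hp r hr)
      have h7 := hammingNorm_add_add u r
      rw [Nat.even_iff] at h6
      have hnn : (0 : ℤ) ≤ (if r = 0 then 32 else 0) + if r = 1 then 32 else 0 := by
        split_ifs <;> norm_num
      refine le_trans ?_ hnn
      have h8 : sgn (r p) = 1 ∨ sgn (r p) = -1 := by
        rcases ZMod.two_eq_zero_or_one (r p) with h | h <;> simp [h]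
      have h9 : hammingNorm (u + r) = 4 ∨ hammingNorm (u + r) = 8 ∨
          hammingNorm (u + r) = 12 := by omega
      rcases h8 with h8 | h8 <;> rcases h9 with h9 | h9 | h9 <;> rw [h8, h9, h] <;>
        norm_num <;> omega
    · have h1 := hammingNorm_add_one u
      have h2 : hammingNorm (u + 1) = 12 := by omega
      rw [h, h16, h2]
      simp
  have hfin := Finset.sum_le_sum hle
  rw [Finset.sum_add_distrib, ← Finset.mul_sum, hsq, hlin, Finset.sum_add_distrib,
    Finset.sum_ite_eq', Finset.sum_ite_eq'] at hfin
  split_ifs at hfin <;> norm_num at hfin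

/-- The linear map adding the parity of a word to its coordinate `p`. -/
def parityShift (p : Fin 16) : (Fin 16 → ZMod 2) →ₗ[ZMod 2] Fin 16 → ZMod 2 :=
  LinearMap.id + LinearMap.smulRight (∑ i, LinearMap.proj i) (Pi.single p 1)

lemma parityShift_apply (p : Fin 16) (v : Fin 16 → ZMod 2) :
    parityShift p v = v + (hammingNorm v : ZMod 2) • Pi.single p 1 := by
  simp [parityShift, ← sum_apply_eq_hammingNorm]

/-- A `[16, 5, 8]` code does not lie in a `[16, 8, 5]` code. -/
lemma not_le_of_finrank_eight (hk : Module.finrank (ZMod 2) R = 5) (hR : MinWtGE R 8)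
    (hk' : Module.finrank (ZMod 2) C = 8) (hC : MinWtGE C 5) : ¬ R ≤ C := by
  intro hRC
  by_cases hev : ∀ v ∈ C, Even (hammingNorm v)
  · refine not_minWtGE_of_finrank_eight hk' fun v hv h0 => ?_
    have h1 := hC v hv h0
    have h2 := hev v hv
    rw [Nat.even_iff] at h2
    omega
  push Not at hev
  obtain ⟨f, hf, hodd⟩ := hev
  obtain ⟨p, hp⟩ := exists_add_single_mem_dualCode hk hR hodd
  have hp' : ∀ g ∈ C, ¬ Even (hammingNorm g) → g + Pi.single p 1 ∈ dualCode R := by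
    intro g hg hgodd
    have h1 : g + f ∈ dualCode R := mem_dualCode_of_even hk hR hRC hC (C.add_mem hg hf) <| by
      have := hammingNorm_add_add g f
      rw [Nat.even_iff] at hodd hgodd ⊢
      omega
    have h2 : g + Pi.single p 1 = g + f + (f + Pi.single p 1) := by
      rw [add_assoc, ← add_assoc f, add_self_word, zero_add]
    rw [h2]
    exact (dualCode R).add_mem h1 hp
  have hwt : ∀ v ∈ C, v ≠ 0 → 6 ≤ hammingNorm (parityShift p v) := by
    intro v hv h0
    have h5 := hC v hv h0
    rw [parityShift_apply]
    by_cases he : Even (hammingNorm v)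
    · rw [ZMod.natCast_eq_zero_iff_even.2 he, zero_smul, add_zero]
      rw [Nat.even_iff] at he
      omega
    · rw [ZMod.natCast_eq_one_iff_odd.2 (Nat.not_even_iff_odd.1 he), one_smul]
      have h1 := hammingNorm_add_single v p
      by_cases hv5 : hammingNorm v = 5
      · rw [apply_eq_zero_of_hammingNorm_eq_five hk hR hRC hC hv hv5 (hp' v hv he), sgn_zero] at h1
        omega
      · have h2 : -1 ≤ sgn (v p) := by
          rcases ZMod.two_eq_zero_or_one (v p) with h | h <;> simp [h]
        rw [Nat.even_iff] at he
        omega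
  refine not_minWtGE_of_finrank_eight (C := LinearMap.range ((parityShift p).comp C.subtype)) ?_ ?_
  · rw [LinearMap.finrank_range_of_inj, hk']
    rw [← LinearMap.ker_eq_bot, LinearMap.ker_eq_bot']
    rintro ⟨v, hv⟩ h
    by_contra h0
    have h1 := hwt v hv fun h1 => h0 (by ext1; exact h1)
    have h2 : parityShift p v = 0 := h
    rw [h2, hammingNorm_zero] at h1
    omega
  · rintro _ ⟨⟨v, hv⟩, rfl⟩ h0
    refine hwt v hv ?_
    rintro rfl
    exact h0 (map_zero _)

end FirstOrderReedMuller

lemma wtCount_dualCode_sixteen_eq_zero {C : Submodule (ZMod 2) (Fin 16 → ZMod 2)}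
    {f : Fin 16 → ZMod 2} (hf : f ∈ C) (hodd : ¬ Even (hammingNorm f)) :
    wtCount (dualCode C) 16 = 0 := by
  refine wtCount_eq_zero fun v hv h => ?_
  rw [eq_one_of_hammingNorm_eq h] at hv
  have h1 := hv f hf
  rw [dotProduct_eq_zero_iff_even, one_mul] at h1
  exact hodd h1

/-- A `[16, 7, 6]` code with an odd word does not contain the all-one word. -/
lemma wtCount_sixteen_eq_zero {C : Submodule (ZMod 2) (Fin 16 → ZMod 2)}
    (hk : Module.finrank (ZMod 2) C = 7) (hC : MinWtGE C 6)
    {f : Fin 16 → ZMod 2} (hf : f ∈ C) (hodd : ¬ Even (hammingNorm f)) :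
    wtCount C 16 = 0 := by
  by_contra h
  have hpos : (1 : ℤ) ≤ wtCount C 16 := by exact_mod_cast Nat.one_le_iff_ne_zero.2 h
  have h0 := macWilliams_zero C
  have h1 := macWilliams_one C
  have h2 := macWilliams_two C
  have h3 := macWilliams_three C
  have h5 := macWilliams_five C
  have h16 := macWilliams_sixteen C
  norm_num [hk, wtCount_zero, hC.wtCount_eq_zero, wtCount_dualCode_sixteen_eq_zero hf hodd]
    at h0 h1 h2 h3 h5 h16
  linarith

/-- Weight counts of a `[16, 4, 8]` code and of its dual, for a code containing three words of
weight at least ten, one of which has weight at least twelve. -/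
lemma wtCount_of_finrank_four {V₀ V₁ V₃ : Submodule (ZMod 2) (Fin 16 → ZMod 2)}
    (h₀₁ : V₀ ≤ V₁) (h₁₃ : V₁ ≤ V₃) (hk₀ : Module.finrank (ZMod 2) V₀ = 1)
    (hk₁ : Module.finrank (ZMod 2) V₁ = 2) (hk₃ : Module.finrank (ZMod 2) V₃ = 4)
    (hV₀ : MinWtGE V₀ 12) (hV₁ : MinWtGE V₁ 10) (hV₃ : MinWtGE V₃ 8) :
    wtCount V₃ 8 = 12 ∧ wtCount (dualCode V₃) 15 = 0 := by
  have h0 := macWilliams_zero V₀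
  have h1 := macWilliams_zero V₁
  have h3 := macWilliams_zero V₃
  have h3' := macWilliams_one V₃
  have h3_last := macWilliams_fifteen V₃
  norm_num [hk₀, hk₁, hk₃, wtCount_zero, hV₀.wtCount_eq_zero, hV₁.wtCount_eq_zero,
    hV₃.wtCount_eq_zero] at h0 h1 h3 h3' h3_last
  have m0 := wtCount_mono h₀₁
  have m1 := wtCount_mono h₁₃
  have m12 := m0 12
  have m13 := m0 13
  have m14 := m0 14
  have m15 := m0 15
  have m16 := m0 16
  have n10 := m1 10
  have n11 := m1 11
  have n12 := m1 12
  have n13 := m1 13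
  have n14 := m1 14
  have n15 := m1 15
  have n16 := m1 16
  zify at m12 m13 m14 m15 m16 n10 n11 n12 n13 n14 n15 n16 ⊢
  have e8 : (wtCount V₃ 8 : ℤ) = 12 := by linarith
  exact ⟨e8, by linarith⟩

/-- A `[16, 7, 6]` code with an odd word has fewer than twelve words of weight eight
if its dual has no word of weight `15`. -/
lemma false_of_finrank_seven {C : Submodule (ZMod 2) (Fin 16 → ZMod 2)}
    (hk : Module.finrank (ZMod 2) C = 7) (hC : MinWtGE C 6)
    {f : Fin 16 → ZMod 2} (hf : f ∈ C) (hodd : ¬ Even (hammingNorm f))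
    (h8 : 12 ≤ wtCount C 8) (h15 : wtCount (dualCode C) 15 = 0) : False := by
  have g0 := macWilliams_zero C
  have g1 := macWilliams_one C
  have g2 := macWilliams_two C
  have g3 := macWilliams_three C
  have g15 := macWilliams_fifteen C
  have g16 := macWilliams_sixteen C
  norm_num [hk, wtCount_zero, hC.wtCount_eq_zero, wtCount_dualCode_sixteen_eq_zero hf hodd, h15]
    at g0 g1 g2 g3 g15 g16
  zify at h8
  linarith

lemma hammingNorm_add_add_le {n : ℕ} (u v : Fin n → ZMod 2) :
    hammingNorm (u + v) + hammingNorm u + hammingNorm v ≤ 2 * n := by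
  have h := hammingNorm_add_add (u + 1) (v + 1)
  have h1 : u + 1 + (v + 1) = u + v := by
    rw [add_add_add_comm, add_self_word, add_zero]
  have h2 := hammingNorm_add_one u
  have h3 := hammingNorm_add_one v
  rw [h1] at h
  omega

/-- The Plotkin bound for the first two distances. -/
lemma plotkin_two {n : ℕ} {V₀ V₁ : Submodule (ZMod 2) (Fin n → ZMod 2)} (h₀₁ : V₀ ≤ V₁)
    (hk₀ : Module.finrank (ZMod 2) V₀ = 1) (hk₁ : Module.finrank (ZMod 2) V₁ = 2) {a b : ℕ}
    (hV₀ : MinWtGE V₀ a) (hV₁ : MinWtGE V₁ b) : a ≤ n ∧ a + 2 * b ≤ 2 * n := by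
  obtain ⟨u, hu, hu0⟩ := Submodule.exists_mem_ne_zero_of_ne_bot (p := V₀) fun h => by
    rw [h, finrank_bot] at hk₀
    omega
  obtain ⟨v, hv, hv0⟩ := SetLike.exists_of_lt (lt_of_le_of_ne h₀₁ fun h => by
    rw [h, hk₁] at hk₀
    omega)
  have h1 := hV₀ u hu hu0
  have h2 := hV₁ v hv fun h => hv0 (h ▸ V₀.zero_mem)
  have h3 := hV₁ (u + v) (V₁.add_mem (h₀₁ hu) hv) fun h => hv0 <| by
    have h4 := V₀.add_mem hu (V₀.zero_mem)
    rw [← h, ← add_assoc, add_self_word, zero_add] at h4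
    exact h4
  have h4 := hammingNorm_add_add_le u v
  have h5 := hammingNorm_le u
  omega

/-- The product of the first two distances is at most `117` under a `[16, 7, 6]` code with an odd
word, through a `[16, 4, 8]` code. -/
lemma mul_le_of_odd {V₀ V₁ V₃ C : Submodule (ZMod 2) (Fin 16 → ZMod 2)}
    (h₀₁ : V₀ ≤ V₁) (h₁₃ : V₁ ≤ V₃) (h₃ : V₃ ≤ C) (hk₀ : Module.finrank (ZMod 2) V₀ = 1)
    (hk₁ : Module.finrank (ZMod 2) V₁ = 2) (hk₃ : Module.finrank (ZMod 2) V₃ = 4)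
    (hk : Module.finrank (ZMod 2) C = 7) {a b : ℕ}
    (hV₀ : MinWtGE V₀ a) (hV₁ : MinWtGE V₁ b) (hV₃ : MinWtGE V₃ 8) (hC : MinWtGE C 6)
    {f : Fin 16 → ZMod 2} (hf : f ∈ C) (hodd : ¬ Even (hammingNorm f)) : a * b ≤ 117 := by
  by_contra! hab
  obtain ⟨ha, hab'⟩ := plotkin_two h₀₁ hk₀ hk₁ hV₀ hV₁
  have hC16 := wtCount_sixteen_eq_zero hk hC hf hodd
  have m3 := wtCount_mono h₃
  have m1 := wtCount_mono h₁₃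
  have m0 := wtCount_mono h₀₁
  have hcases : 15 ≤ a ∨ a = 14 ∧ b = 9 ∨ a = 12 ∧ b = 10 := by
    interval_cases a <;> omega
  rcases hcases with ha15 | ⟨rfl, rfl⟩ | ⟨rfl, rfl⟩
  · have h15 := hV₀.mono ha15
    have h0 := macWilliams_zero V₀
    have h3 := macWilliams_zero V₃
    have h3' := macWilliams_one V₃
    have h3_last := macWilliams_sixteen V₃
    norm_num [hk₀, hk₃, wtCount_zero, h15.wtCount_eq_zero, hV₃.wtCount_eq_zero]
      at h0 h3 h3' h3_last
    have i15 := m0 15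
    have i16 := m0 16
    have j15 := m1 15
    have j16 := m1 16
    have k16 := m3 16
    rw [hC16] at k16
    zify at i15 i16 j15 j16 k16
    have hlow : (1 : ℤ) ≤
        wtCount V₃ 9 + wtCount V₃ 11 + wtCount V₃ 13 + wtCount V₃ 15 := by linarith
    have hupp : (wtCount V₃ 9 + wtCount V₃ 11 + wtCount V₃ 13 + wtCount V₃ 15 : ℤ) ≤ 2 := by
      linarith
    have hdiv : (16 : ℤ) - 2 * (wtCount V₃ 9 + wtCount V₃ 11 + wtCount V₃ 13 + wtCount V₃ 15) =
        16 * wtCount (dualCode V₃) 16 := by linarith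
    omega
  · have h0 := macWilliams_zero V₀
    have h1 := macWilliams_zero V₁
    have h3 := macWilliams_zero V₃
    have h3' := macWilliams_one V₃
    have h3_last := macWilliams_sixteen V₃
    norm_num [hk₀, hk₁, hk₃, wtCount_zero, hV₀.wtCount_eq_zero, hV₁.wtCount_eq_zero,
      hV₃.wtCount_eq_zero] at h0 h1 h3 h3' h3_last
    have i14 := m0 14
    have i15 := m0 15
    have i16 := m0 16
    have j9 := m1 9
    have j10 := m1 10
    have j11 := m1 11
    have j12 := m1 12
    have j13 := m1 13
    have j14 := m1 14
    have j15 := m1 15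
    have j16 := m1 16
    zify at i14 i15 i16 j9 j10 j11 j12 j13 j14 j15 j16
    have hdiv : (12 : ℤ) = 16 * wtCount (dualCode V₃) 16 := by linarith
    omega
  · obtain ⟨h8, h15⟩ := wtCount_of_finrank_four h₀₁ h₁₃ hk₀ hk₁ hk₃ hV₀ hV₁ hV₃
    refine false_of_finrank_seven hk hC hf hodd (h8 ▸ m3 8) ?_
    exact Nat.le_zero.1 (h15 ▸ wtCount_mono (dualCode_anti h₃) 15)

lemma hammingDist_eq_hammingNorm_add {n : ℕ} (u v : Fin n → ZMod 2) :
    hammingDist u v = hammingNorm (u + v) := by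
  rw [hammingDist_eq_hammingNorm, neg_eq_of_add_eq_zero_left (add_self_word u)]

section Chain

variable {ℓ : ℕ} {G : Matrix (Fin ℓ) (Fin ℓ) (ZMod 2)}

lemma partialDist_le {i : Fin ℓ} {c : Fin ℓ → ZMod 2}
    (hc : c ∈ Submodule.span (ZMod 2) {v : Fin ℓ → ZMod 2 | ∃ j, i < j ∧ v = G j}) :
    partialDist G i ≤ hammingNorm (G i + c) := by
  exact Nat.sInf_le ⟨c, hc, (hammingDist_eq_hammingNorm_add _ _).symm⟩

lemma exists_eq_partialDist (G : Matrix (Fin ℓ) (Fin ℓ) (ZMod 2)) (i : Fin ℓ) :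
    ∃ c ∈ Submodule.span (ZMod 2) {v : Fin ℓ → ZMod 2 | ∃ j, i < j ∧ v = G j},
      partialDist G i = hammingNorm (G i + c) := by
  obtain ⟨c, hc, h⟩ := Nat.sInf_mem (s := {d : ℕ | ∃ c ∈ Submodule.span (ZMod 2)
    {v : Fin ℓ → ZMod 2 | ∃ j, i < j ∧ v = G j}, d = hammingDist (G i) c})
    ⟨_, 0, zero_mem _, rfl⟩
  exact ⟨c, hc, h.trans (hammingDist_eq_hammingNorm_add _ _)⟩

lemma one_le_partialDist (hG : IsUnit G) (i : Fin ℓ) : 1 ≤ partialDist G i := by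
  obtain ⟨c, hc, h⟩ := exists_eq_partialDist G i
  rw [h, Nat.one_le_iff_ne_zero, Ne, hammingNorm_eq_zero]
  intro h0
  have hli : LinearIndependent (ZMod 2) G := Matrix.linearIndependent_rows_iff_isUnit.2 hG
  refine hli.notMem_span_image (s := {j | i < j}) (x := i) (by simp) ?_
  have h1 : G i = c := by
    rw [← add_zero (G i), ← add_self_word c, ← add_assoc, h0, zero_add]
  rw [h1]
  refine Submodule.span_mono ?_ hc
  rintro v ⟨j, hj, rfl⟩
  exact ⟨j, hj, rfl⟩

/-- A nonzero combination of rows of `G` has at least the weight of the partial distance of one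
of these rows. -/
lemma exists_partialDist_le {ι : Type*} [Fintype ι] {e : ι → Fin ℓ} (he : Function.Injective e)
    {x : ι → ZMod 2} (hx : ∑ j, x j • G (e j) ≠ 0) :
    ∃ j, partialDist G (e j) ≤ hammingNorm (∑ j, x j • G (e j)) := by
  classical
  have hne : (Finset.univ.filter fun j => x j ≠ 0).Nonempty := by
    by_contra h
    rw [Finset.not_nonempty_iff_eq_empty, Finset.filter_eq_empty_iff] at h
    refine hx (Finset.sum_eq_zero fun j hj => ?_)
    rw [not_not.1 (h hj), zero_smul]
  obtain ⟨m, hm, hmin⟩ := Finset.exists_min_image _ e hne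
  have hxm : x m = 1 := (ZMod.two_eq_zero_or_one _).resolve_left (Finset.mem_filter.1 hm).2
  refine ⟨m, ?_⟩
  rw [← Finset.add_sum_erase _ _ (Finset.mem_univ m), hxm, one_smul]
  refine partialDist_le (Submodule.sum_mem _ fun j hj => ?_)
  by_cases h0 : x j = 0
  · rw [h0, zero_smul]
    exact zero_mem _
  · refine Submodule.smul_mem _ _ (Submodule.subset_span ⟨e j, ?_, rfl⟩)
    refine lt_of_le_of_ne (hmin j (by simp [h0])) fun h => ?_
    exact (Finset.mem_erase.1 hj).1 (he h).symm

/-- Sorting the partial distances yields a flag of codes whose minimum distances are bounded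
below by them. -/
lemma exists_flag (hG : IsUnit G) :
    ∃ (b : Fin ℓ → ℕ) (V : Fin ℓ → Submodule (ZMod 2) (Fin ℓ → ZMod 2)),
      Antitone b ∧ ∏ i, b i = ∏ i, partialDist G i ∧ Monotone V ∧
        (∀ i, Module.finrank (ZMod 2) (V i) = i + 1) ∧ ∀ i, MinWtGE (V i) (b i) := by
  let σ : Equiv.Perm (Fin ℓ) := Tuple.sort fun i => OrderDual.toDual (partialDist G i)
  have hb : Antitone fun i => partialDist G (σ i) := fun i j hij =>
    Tuple.monotone_sort (fun i => OrderDual.toDual (partialDist G i)) hij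
  have hli : LinearIndependent (ZMod 2) G := Matrix.linearIndependent_rows_iff_isUnit.2 hG
  have hinj : ∀ i, Function.Injective fun j : {j // j ≤ i} => σ j := fun _ _ _ h =>
    Subtype.ext (σ.injective h)
  refine ⟨fun i => partialDist G (σ i),
    fun i => Submodule.span (ZMod 2) (Set.range fun j : {j // j ≤ i} => G (σ j)), hb,
    Equiv.prod_comp σ fun i => partialDist G i, ?_, fun i => ?_, fun i v hv h0 => ?_⟩
  · intro i k hik
    refine Submodule.span_mono ?_
    rintro _ ⟨j, rfl⟩
    exact ⟨⟨j, j.2.trans hik⟩, rfl⟩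
  · refine (finrank_span_eq_card (hli.comp _ (hinj i))).trans ?_
    exact (Fintype.card_of_subtype (Finset.Iic i) fun _ => Finset.mem_Iic).trans (Fin.card_Iic i)
  · obtain ⟨x, rfl⟩ := (Submodule.mem_span_range_iff_exists_fun _).1 hv
    obtain ⟨j, hj⟩ := exists_partialDist_le (hinj i) h0
    exact (hb j.2).trans hj

end Chain

lemma prod_flag_le {b : Fin 16 → ℕ} {V : Fin 16 → Submodule (ZMod 2) (Fin 16 → ZMod 2)}
    (hb : Antitone b) (hV : Monotone V) (hk : ∀ i, Module.finrank (ZMod 2) (V i) = i + 1)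
    (hd : ∀ i, MinWtGE (V i) (b i)) : ∏ i, b i ≤ 2 ^ 30 * 3 ^ 2 := by
  have h15 : b 15 ≤ 1 := by
    have hr : V 15 = ⊤ := by
      apply Submodule.eq_top_of_finrank_eq
      rw [hk]
      simp
    have h := hd 15 (Pi.single 0 1) (hr ▸ Submodule.mem_top) (by simp)
    rwa [hammingNorm_single] at h
  have h11 : b 11 ≤ 2 := by
    by_contra! h
    exact not_minWtGE_of_finrank_twelve (hk 11) ((hd 11).mono h)
  have h8 : b 8 ≤ 4 := by
    by_contra! h
    exact not_minWtGE_of_finrank_nine (hk 8) ((hd 8).mono h)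
  have h7 : b 7 ≤ 5 := by
    by_contra! h
    exact not_minWtGE_of_finrank_eight (hk 7) ((hd 7).mono h)
  have h5 : b 5 ≤ 6 := by
    by_contra! h
    exact not_minWtGE_of_finrank_six (hk 5) ((hd 5).mono h)
  have h2 : b 2 ≤ 8 := by
    by_contra! h
    exact not_minWtGE_of_finrank_three (hk 2) ((hd 2).mono h)
  have h01 : b 0 * b 1 ≤ 128 := by
    obtain ⟨h0, h1⟩ := plotkin_two (hV (by decide : (0 : Fin 16) ≤ 1)) (hk 0) (hk 1) (hd 0) (hd 1)
    generalize b 0 = x at *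
    interval_cases x <;> omega
  have h3 : b 3 ≤ b 2 := hb (by decide)
  have h4 : b 4 ≤ b 3 := hb (by decide)
  have h6 : b 6 ≤ b 5 := hb (by decide)
  have h9 : b 9 ≤ 4 := (hb (by decide : (8 : Fin 16) ≤ 9)).trans h8
  have h10 : b 10 ≤ 4 := (hb (by decide : (8 : Fin 16) ≤ 10)).trans h8
  have h12 : b 12 ≤ 2 := (hb (by decide : (11 : Fin 16) ≤ 12)).trans h11
  have h13 : b 13 ≤ 2 := (hb (by decide : (11 : Fin 16) ≤ 13)).trans h11
  have h14 : b 14 ≤ 2 := (hb (by decide : (11 : Fin 16) ≤ 14)).trans h11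
  have hprod : ∏ i, b i = b 0 * b 1 * b 2 * b 3 * b 4 * b 5 * b 6 * b 7 *
      (b 8 * b 9 * b 10 * b 11 * b 12 * b 13 * b 14 * b 15) := by
    simp only [Fin.prod_univ_succ, Fin.prod_univ_zero]
    simp [mul_assoc, Fin.succ]
  have htail : b 8 * b 9 * b 10 * b 11 * b 12 * b 13 * b 14 * b 15 ≤
      4 * 4 * 4 * 2 * 2 * 2 * 2 * 1 := by gcongr
  have key : ∀ m x₂ x₃ x₄ x₅ x₆ x₇ : ℕ, b 0 * b 1 ≤ m → b 2 ≤ x₂ → b 3 ≤ x₃ → b 4 ≤ x₄ →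
      b 5 ≤ x₅ → b 6 ≤ x₆ → b 7 ≤ x₇ →
      m * x₂ * x₃ * x₄ * x₅ * x₆ * x₇ * (4 * 4 * 4 * 2 * 2 * 2 * 2 * 1) ≤ 2 ^ 30 * 3 ^ 2 →
      ∏ i, b i ≤ 2 ^ 30 * 3 ^ 2 := by
    intro m x₂ x₃ x₄ x₅ x₆ x₇ hm k₂ k₃ k₄ k₅ k₆ k₇ hle
    refine le_trans ?_ hle
    rw [hprod]
    gcongr
  by_cases h7' : b 7 ≤ 4
  · exact key 128 8 8 8 6 6 4 h01 h2 (by omega) (by omega) h5 (by omega) h7' (by norm_num)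
  by_cases h4' : b 4 ≤ 6
  · exact key 128 8 8 6 6 6 5 h01 h2 (by omega) h4' h5 (by omega) h7 (by norm_num)
  have hnot : ¬ MinWtGE (V 4) 8 := fun h =>
    not_le_of_finrank_eight (hk 4) h (hk 7) ((hd 7).mono (by omega)) (hV (by decide))
  have h4_le : b 4 ≤ 7 := by
    by_contra! h
    exact hnot ((hd 4).mono h)
  by_cases h6' : b 6 ≤ 5
  · exact key 128 8 8 7 6 5 5 h01 h2 (by omega) h4_le h5 h6' h7 (by norm_num)
  by_cases h3' : b 3 ≤ 7
  · exact key 128 8 7 7 6 6 5 h01 h2 h3' h4_le h5 (by omega) h7 (by norm_num)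
  obtain ⟨f, hf, hodd⟩ : ∃ f ∈ V 4, ¬ Even (hammingNorm f) := by
    by_contra! h
    refine hnot fun v hv h0 => ?_
    have h1 := hd 4 v hv h0
    have h2 := h v hv
    rw [Nat.even_iff] at h2
    omega
  refine key 117 8 8 7 6 6 5 ?_ h2 (by omega) h4_le h5 (by omega) h7 (by norm_num)
  exact mul_le_of_odd (hV (by decide : (0 : Fin 16) ≤ 1)) (hV (by decide : (1 : Fin 16) ≤ 3))
    (hV (by decide : (3 : Fin 16) ≤ 6)) (hk 0) (hk 1) (hk 3) (hk 6) (hd 0) (hd 1)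
    ((hd 3).mono (by omega)) ((hd 6).mono (by omega)) (hV (by decide : (4 : Fin 16) ≤ 6) hf) hodd

lemma prod_partialDist_le {G : Matrix (Fin 16) (Fin 16) (ZMod 2)} (hG : IsUnit G) :
    ∏ i, partialDist G i ≤ 2 ^ 30 * 3 ^ 2 := by
  obtain ⟨b, V, hb, hprod, hV, hk, hd⟩ := exists_flag hG
  rw [← hprod]
  exact prod_flag_le hb hV hk hd

lemma expE_eq_logb_prod {ℓ : ℕ} {G : Matrix (Fin ℓ) (Fin ℓ) (ZMod 2)} (hG : IsUnit G) :
    expE G = (1 / ℓ : ℝ) * Real.logb ℓ ((∏ i, partialDist G i : ℕ) : ℝ) := by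
  rw [expE, Nat.cast_prod, Real.logb_prod]
  intro i _
  have h := one_le_partialDist hG i
  exact_mod_cast (Nat.one_le_iff_ne_zero.1 h)

lemma le_partialDist {ℓ : ℕ} {G : Matrix (Fin ℓ) (Fin ℓ) (ZMod 2)} (hG : IsUnit G) {i : Fin ℓ}
    {P : Submodule (ZMod 2) (Fin ℓ → ZMod 2)} {d : ℕ} (hP : MinWtGE P d)
    (hmem : ∀ j, i ≤ j → G j ∈ P) : d ≤ partialDist G i := by
  obtain ⟨c, hc, h⟩ := exists_eq_partialDist G i
  have h1 := one_le_partialDist hG i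
  rw [h] at h1 ⊢
  have hcP : c ∈ P := by
    refine Submodule.span_le.2 ?_ hc
    rintro _ ⟨j, hj, rfl⟩
    exact hmem j hj.le
  refine hP _ (P.add_mem (hmem i le_rfl) hcP) fun h0 => ?_
  rw [h0, hammingNorm_zero] at h1
  omega

section Witness

/-- The binary square matrix whose rows are given by the binary digits of natural numbers. -/
def matrixOfBits {ℓ : ℕ} (r : Fin ℓ → ℕ) : Matrix (Fin ℓ) (Fin ℓ) (ZMod 2) :=
  fun i j => if (r i).testBit j then 1 else 0

/-- A `16 × 16` matrix of optimal exponent. Its rows are the evaluations of the monomials of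
degree four and three, of four quadratic monomials, of two quadratic forms all of whose nonzero
combinations are bent, and of the monomials of degree one and zero. -/
def optimalMatrix : Matrix (Fin 16) (Fin 16) (ZMod 2) :=
  matrixOfBits ![32768, 49152, 40960, 34816, 32896, 34952, 41120, 43520, 49344, 30856, 58408,
    43690, 52428, 61680, 65280, 65535]

lemma isUnit_optimalMatrix : IsUnit optimalMatrix := by
  refine IsUnit.of_mul_eq_one (matrixOfBits ![65471, 2301, 5467, 57, 9079, 85, 275, 17, 18127,
    141, 1131, 9, 551, 5, 3, 1]) ?_
  decide +kernel

lemma optimalMatrix_fifteen : optimalMatrix 15 = (1 : Fin 16 → ZMod 2) := by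
  decide +kernel

lemma minWtGE_dualCode_span_one {n : ℕ} :
    MinWtGE (dualCode (Submodule.span (ZMod 2) {(1 : Fin n → ZMod 2)})) 2 := by
  intro v hv h0
  have h1 := hv 1 (Submodule.mem_span_singleton_self _)
  rw [dotProduct_eq_zero_iff_even, mul_one, Nat.even_iff] at h1
  have h2 : hammingNorm v ≠ 0 := fun h => h0 (hammingNorm_eq_zero.1 h)
  omega

lemma mem_dualCode_span {n : ℕ} {S : Set (Fin n → ZMod 2)} {u : Fin n → ZMod 2} :
    u ∈ dualCode (Submodule.span (ZMod 2) S) ↔ ∀ c ∈ S, u ⬝ᵥ c = 0 := by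
  refine ⟨fun h c hc => h c (Submodule.subset_span hc), fun h c hc => ?_⟩
  induction hc using Submodule.span_induction with
  | mem c hc => exact h c hc
  | zero => exact dotProduct_zero u
  | add c d _ _ hc hd => rw [dotProduct_add, hc, hd, add_zero]
  | smul a c _ hc => rw [dotProduct_smul, hc, smul_zero]

/-- The dual of a code that contains the all-one word and separates coordinates has minimum
distance at least four. -/
lemma minWtGE_dualCode_four {n : ℕ} {C : Submodule (ZMod 2) (Fin n → ZMod 2)} (hone : 1 ∈ C)
    (hsep : ∀ p q, p ≠ q → ∃ c ∈ C, c p + c q ≠ 0) : MinWtGE (dualCode C) 4 := by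
  intro v hv h0
  have h1 := hv 1 hone
  rw [dotProduct_eq_zero_iff_even, mul_one, Nat.even_iff] at h1
  have h2 : hammingNorm v ≠ 0 := fun h => h0 (hammingNorm_eq_zero.1 h)
  have h3 : hammingNorm v ≠ 2 := by
    intro h
    rw [hammingNorm_eq_card, Finset.card_eq_two] at h
    obtain ⟨p, q, hpq, h⟩ := h
    obtain ⟨c, hc, hne⟩ := hsep p q hpq
    have h4 := hv c hc
    have h5 : ∀ i, v i * c i = if i ∈ ({p, q} : Finset (Fin n)) then c i else 0 := by
      intro i
      rw [← h]
      rcases ZMod.two_eq_zero_or_one (v i) with hi | hi <;> simp [hi]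
    rw [dotProduct, Finset.sum_congr rfl fun i _ => h5 i, Finset.sum_ite_mem,
      Finset.univ_inter, Finset.sum_pair hpq] at h4
    exact hne h4
  omega

lemma minWtGE_span_range {n : ℕ} {ι : Type*} [Fintype ι] {g : ι → Fin n → ZMod 2} {d : ℕ}
    (h : ∀ x : ι → ZMod 2, ∑ i, x i • g i = 0 ∨ d ≤ hammingNorm (∑ i, x i • g i)) :
    MinWtGE (Submodule.span (ZMod 2) (Set.range g)) d := by
  intro v hv h0
  obtain ⟨x, rfl⟩ := (Submodule.mem_span_range_iff_exists_fun _).1 hv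
  exact (h x).resolve_left h0

lemma le_partialDist_optimalMatrix (i : Fin 16) :
    (![1, 2, 2, 2, 2, 4, 4, 4, 4, 6, 6, 8, 8, 8, 8, 16] : Fin 16 → ℕ) i ≤
      partialDist optimalMatrix i := by
  have h2 : ∀ i : Fin 16, 1 ≤ i → 2 ≤ partialDist optimalMatrix i := fun i hi => by
    refine le_partialDist isUnit_optimalMatrix minWtGE_dualCode_span_one fun j hj => ?_
    rw [mem_dualCode_span]
    rintro _ rfl
    have key : ∀ j : Fin 16, 1 ≤ j → optimalMatrix j ⬝ᵥ 1 = 0 := by decide +kernel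
    exact key j (hi.trans hj)
  have h4 : ∀ i : Fin 16, 5 ≤ i → 4 ≤ partialDist optimalMatrix i := fun i hi => by
    refine le_partialDist isUnit_optimalMatrix (minWtGE_dualCode_four
      (C := Submodule.span (ZMod 2) (Set.range fun k : Fin 5 => optimalMatrix (Fin.natAdd 11 k)))
      (Submodule.subset_span ⟨4, optimalMatrix_fifteen⟩) fun p q hpq => ?_) fun j hj => ?_
    · have key : ∀ p q : Fin 16, p ≠ q → ∃ k : Fin 5,
          optimalMatrix (Fin.natAdd 11 k) p + optimalMatrix (Fin.natAdd 11 k) q ≠ 0 := by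
        decide +kernel
      obtain ⟨k, hk⟩ := key p q hpq
      exact ⟨_, Submodule.subset_span ⟨k, rfl⟩, hk⟩
    · rw [mem_dualCode_span]
      rintro _ ⟨k, rfl⟩
      have key : ∀ (j : Fin 16) (k : Fin 5), 5 ≤ j →
          optimalMatrix j ⬝ᵥ optimalMatrix (Fin.natAdd 11 k) = 0 := by decide +kernel
      exact key j k (hi.trans hj)
  have h6 : ∀ i : Fin 16, 9 ≤ i → 6 ≤ partialDist optimalMatrix i := fun i hi => by
    refine le_partialDist isUnit_optimalMatrix (minWtGE_span_range
      (g := fun k : Fin 7 => optimalMatrix (Fin.natAdd 9 k)) ?_) fun j hj => ?_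
    · decide +kernel
    · have key : ∀ j : Fin 16, 9 ≤ j → ∃ k : Fin 7, Fin.natAdd 9 k = j := by decide
      obtain ⟨k, rfl⟩ := key j (hi.trans hj)
      exact Submodule.subset_span ⟨k, rfl⟩
  have h8 : ∀ i : Fin 16, 11 ≤ i → 8 ≤ partialDist optimalMatrix i := fun i hi => by
    refine le_partialDist isUnit_optimalMatrix (minWtGE_span_range
      (g := fun k : Fin 5 => optimalMatrix (Fin.natAdd 11 k)) ?_) fun j hj => ?_
    · decide +kernel
    · have key : ∀ j : Fin 16, 11 ≤ j → ∃ k : Fin 5, Fin.natAdd 11 k = j := by decide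
      obtain ⟨k, rfl⟩ := key j (hi.trans hj)
      exact Submodule.subset_span ⟨k, rfl⟩
  have h16 : 16 ≤ partialDist optimalMatrix 15 := by
    refine le_partialDist isUnit_optimalMatrix (minWtGE_span_range
      (g := fun _ : Fin 1 => (1 : Fin 16 → ZMod 2)) ?_) fun j hj => ?_
    · decide +kernel
    · rw [le_antisymm (Fin.le_last j) hj]
      exact Submodule.subset_span ⟨0, optimalMatrix_fifteen.symm⟩
  fin_cases i
  · exact one_le_partialDist isUnit_optimalMatrix 0
  · exact h2 1 (by decide)
  · exact h2 2 (by decide)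
  · exact h2 3 (by decide)
  · exact h2 4 (by decide)
  · exact h4 5 (by decide)
  · exact h4 6 (by decide)
  · exact h4 7 (by decide)
  · exact h4 8 (by decide)
  · exact h6 9 (by decide)
  · exact h6 10 (by decide)
  · exact h8 11 (by decide)
  · exact h8 12 (by decide)
  · exact h8 13 (by decide)
  · exact h8 14 (by decide)
  · exact h16

lemma prod_partialDist_optimalMatrix :
    ∏ i, partialDist optimalMatrix i = 2 ^ 30 * 3 ^ 2 := by
  refine le_antisymm (prod_partialDist_le isUnit_optimalMatrix) ?_
  have h := Finset.prod_le_prod' (s := Finset.univ) fun i _ => le_partialDist_optimalMatrix i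
  refine le_trans (le_of_eq ?_) h
  decide

end Witness

lemma logb_sixteen : (1 / (16 : ℕ) : ℝ) * Real.logb (16 : ℕ) ((2 ^ 30 * 3 ^ 2 : ℕ) : ℝ) =
    (30 + 2 * Real.logb 2 3) / 64 := by
  have h16 : Real.log 16 = 4 * Real.log 2 := by
    rw [show (16 : ℝ) = 2 ^ 4 by norm_num, Real.log_pow]
    norm_num
  have hlog : Real.log 2 ≠ 0 := (Real.log_pos (by norm_num)).ne'
  rw [show ((2 ^ 30 * 3 ^ 2 : ℕ) : ℝ) = 2 ^ 30 * 3 ^ 2 by norm_num, Nat.cast_ofNat,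
    Real.logb, Real.logb, Real.log_mul (by norm_num) (by norm_num), Real.log_pow,
    Real.log_pow, h16]
  push_cast
  field_simp
  ring

/-- Every invertible `16×16` matrix `G` over GF(2) satisfies
`∏_{i=1}^{16} D_i ≤ 2³⁰·3²`; consequently `E₁₆ = (30 + 2 log₂ 3)/64 ≈ 0.51828`
is the best possible exponent among all `16×16` matrices. -/
theorem stmt16 :
    (∀ G : Matrix (Fin 16) (Fin 16) (ZMod 2), IsUnit G →
        (∏ i, partialDist G i) ≤ 2 ^ 30 * 3 ^ 2) ∧
      Emax 16 = (30 + 2 * Real.logb 2 3) / 64 := by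
  refine ⟨fun G hG => prod_partialDist_le hG, IsGreatest.csSup_eq ⟨?_, ?_⟩⟩
  · refine ⟨optimalMatrix, isUnit_optimalMatrix, ?_⟩
    rw [expE_eq_logb_prod isUnit_optimalMatrix, prod_partialDist_optimalMatrix, logb_sixteen]
  · rintro _ ⟨G, hG, rfl⟩
    rw [expE_eq_logb_prod hG, ← logb_sixteen]
    have hpos : 0 < ∏ i, partialDist G i := Finset.prod_pos fun i _ => one_le_partialDist hG i
    refine mul_le_mul_of_nonneg_left ?_ (by positivity)
    refine Real.logb_le_logb_of_le (by norm_num) (by exact_mod_cast hpos) ?_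
    exact_mod_cast prod_partialDist_le hG
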